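/- Let $S = K[x_1, \ldots, x_{n+1}]$ with $I_2(N)$ the ideal of $2\times2$ minors of the matrix with rows $(x_1,\ldots,x_n)$, $(x_2,\ldots,x_{n+1})$, and let $a, b, c \geq 1$. Then the images of $x_1^a + x_{n+1}^b$ and $x_n^c$ form a regular sequence on $S/I_2(N)$, and consequently $I_2(N) \cap \langle x_1^a + x_{n+1}^b, x_n^c \rangle = I_2(N) \cdot \langle x_1^a + x_{n+1}^b, x_n^c \rangle$. -/

import Mathlib

open MvPolynomial

/-- Normal form monomials: degree `d`, weight `w`. -/
def rncNF {Q : Type} [CommRing Q] (y : ℕ → Q) (n : ℕ) : ℕ → ℕ → Q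
  | 0, _ => 1
  | d + 1, w => if n ≤ w then y n * rncNF y n d (w - n) else y w * y 0 ^ d

theorem rnc_shift {Q : Type} [CommRing Q] (y : ℕ → Q) (n : ℕ)
    (h : ∀ i j, i < n → j < n → y i * y (j + 1) = y (i + 1) * y j) (m : ℕ) :
    ∀ i j, i + m ≤ n → j + m ≤ n → y (i + m) * y j = y i * y (j + m) := by
  induction m with
  | zero => intro i j _ _; rfl
  | succ m ih =>
    intro i j hi hj
    have h1 := ih (i + 1) j (by omega) (by omega)
    have h2 := h i (j + m) (by omega) (by omega)
    rw [show i + (m + 1) = i + 1 + m by ring, h1, ← h2, show j + m + 1 = j + (m + 1) by ring]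

theorem rnc_swap {Q : Type} [CommRing Q] (y : ℕ → Q) (n : ℕ)
    (h : ∀ i j, i < n → j < n → y i * y (j + 1) = y (i + 1) * y j)
    (i j k l : ℕ) (hi : i ≤ n) (hj : j ≤ n) (hk : k ≤ n) (hl : l ≤ n) (e : i + j = k + l) :
    y i * y j = y k * y l := by
  rcases le_total k i with hki | hki
  · obtain ⟨m, rfl⟩ := Nat.exists_eq_add_of_le hki
    obtain rfl : l = j + m := by omega
    exact rnc_shift y n h m k j hi hl
  · obtain ⟨m, rfl⟩ := Nat.exists_eq_add_of_le hki
    obtain rfl : j = l + m := by omega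
    exact (rnc_shift y n h m i l hk hj).symm

theorem rnc_mul_nf {Q : Type} [CommRing Q] (y : ℕ → Q) (n : ℕ) (hn : 1 ≤ n)
    (h : ∀ i j, i < n → j < n → y i * y (j + 1) = y (i + 1) * y j)
    (i : ℕ) (hi : i ≤ n) (d : ℕ) :
    ∀ w, w ≤ n * d → y i * rncNF y n d w = rncNF y n (d + 1) (w + i) := by
  induction d with
  | zero =>
    intro w hw
    obtain rfl : w = 0 := by omega
    simp only [rncNF, mul_one, zero_add, pow_zero]
    split_ifs with h1
    · obtain rfl : i = n := by omega
      rfl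
    · rfl
  | succ d ih =>
    intro w hw
    rw [Nat.mul_succ] at hw
    by_cases h1 : n ≤ w
    · have := ih (w - n) (by omega)
      rw [rncNF, if_pos h1, rncNF, if_pos (by omega : n ≤ w + i),
        show w + i - n = w - n + i by omega, ← this]
      ring
    · rw [rncNF, if_neg h1, rncNF]
      split_ifs with h2
      · have e := rnc_swap y n h i w n (w + i - n) hi (by omega) le_rfl (by omega) (by omega)
        rw [rncNF, if_neg (by omega), ← mul_assoc, e, mul_assoc]
      · have e := rnc_swap y n h i w (w + i) 0 hi (by omega) (by omega) (by omega) (by omega)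
        rw [← mul_assoc, e, pow_succ]
        ring

theorem rnc_map_nf {Q P : Type} [CommRing Q] [CommRing P] (g : Q →+* P) (y : ℕ → Q) (n d : ℕ) :
    ∀ w, g (rncNF y n d w) = rncNF (fun k => g (y k)) n d w := by
  induction d with
  | zero => intro w; simp [rncNF]
  | succ d ih =>
    intro w
    simp only [rncNF]
    split_ifs
    · simp [ih]
    · simp

theorem rnc_eval_nf {P : Type} [CommRing P] (s t : P) (n d : ℕ) :
    ∀ A B, A + B = n * d → rncNF (fun k => s ^ (n - k) * t ^ k) n d B = s ^ A * t ^ B := by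
  induction d with
  | zero =>
    intro A B h
    obtain rfl : A = 0 := by omega
    obtain rfl : B = 0 := by omega
    simp [rncNF]
  | succ d ih =>
    intro A B h
    rw [Nat.mul_succ] at h
    simp only [rncNF]
    split_ifs with h1
    · rw [ih A (B - n) (by omega)]
      obtain ⟨m, rfl⟩ := Nat.exists_eq_add_of_le h1
      simp only [Nat.sub_self, Nat.add_sub_cancel_left]
      ring
    · simp only [Nat.sub_zero, pow_zero, mul_one]
      rw [show A = (n - B) + n * d by omega, pow_add, pow_mul]
      ring

/-- The parametrization of the rational normal curve. -/
noncomputable def rncPhi (K : Type) [Field K] (n : ℕ) :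
    MvPolynomial (Fin (n + 1)) K →ₐ[K] MvPolynomial (Fin 2) K :=
  aeval (fun i => X 0 ^ (n - i.val) * X 1 ^ i.val)

/-- Variables indexed by naturals. -/
noncomputable def rncX (K : Type) [Field K] (n : ℕ) (k : ℕ) : MvPolynomial (Fin (n + 1)) K :=
  if h : k < n + 1 then X ⟨k, h⟩ else
    0

theorem rnc_mono {K : Type} [Field K] (m : Fin 2 →₀ ℕ) :
    (monomial m (1 : K)) = X 0 ^ m 0 * X 1 ^ m 1 := by
  rw [monomial_eq, Finsupp.prod_fintype _ _ (by simp)]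
  simp [Fin.prod_univ_two]

theorem rnc_phi_nf {K : Type} [Field K] (n : ℕ) (d A B : ℕ) (h : A + B = n * d) :
    ∃ p, rncPhi K n p = X 0 ^ A * X 1 ^ B := by
  refine ⟨rncNF (rncX K n) n d B, ?_⟩
  rw [← rnc_eval_nf (X 0) (X 1) n d A B h]
  clear h
  have : ∀ k, k ≤ n → rncPhi K n (rncX K n k) = X 0 ^ (n - k) * X 1 ^ k := by
    intro k hk
    rw [rncX, dif_pos (by omega), rncPhi, aeval_X]
  induction d generalizing B with
  | zero => simp [rncNF]
  | succ d ih =>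
    simp only [rncNF]
    split_ifs with h1
    · rw [map_mul, ih, this n le_rfl]
    · rw [map_mul, map_pow, this B (by omega), this 0 (by omega)]

theorem rnc_monom {K : Type} [Field K] (n : ℕ) (hn : 1 ≤ n)
    (I2 : Ideal (MvPolynomial (Fin (n + 1)) K))
    (hI2 : I2 = Ideal.span {f | ∃ i j : Fin n,
      f = X i.castSucc * X j.succ - X i.succ * X j.castSucc}) (e : Fin (n + 1) →₀ ℕ) :
    ∃ d A B, A + B = n * d ∧ rncPhi K n (monomial e 1) = X 0 ^ A * X 1 ^ B ∧
      Ideal.Quotient.mk I2 (monomial e 1) =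
        rncNF (fun k => Ideal.Quotient.mk I2 (rncX K n k)) n d B := by
  have hrel : ∀ i j, i < n → j < n →
      Ideal.Quotient.mk I2 (rncX K n i) * Ideal.Quotient.mk I2 (rncX K n (j + 1)) =
      Ideal.Quotient.mk I2 (rncX K n (i + 1)) * Ideal.Quotient.mk I2 (rncX K n j) := by
    intro i j hi hj
    rw [← map_mul, ← map_mul, Ideal.Quotient.eq, hI2]
    apply Ideal.subset_span
    refine ⟨⟨i, hi⟩, ⟨j, hj⟩, ?_⟩
    simp only [rncX]
    rw [dif_pos (by omega), dif_pos (by omega), dif_pos (by omega), dif_pos (by omega)]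
    rfl
  have key : ∀ (p : MvPolynomial (Fin (n + 1)) K) (i : Fin (n + 1)),
      (∃ d A B, A + B = n * d ∧ rncPhi K n p = X 0 ^ A * X 1 ^ B ∧
      Ideal.Quotient.mk I2 p =
        rncNF (fun k => Ideal.Quotient.mk I2 (rncX K n k)) n d B) →
      (∃ d A B, A + B = n * d ∧ rncPhi K n (p * X i) = X 0 ^ A * X 1 ^ B ∧
      Ideal.Quotient.mk I2 (p * X i) =
        rncNF (fun k => Ideal.Quotient.mk I2 (rncX K n k)) n d B) := by
    rintro p i ⟨d, A, B, h1, h2, h3⟩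
    refine ⟨d + 1, A + (n - i.val), B + i.val, ?_, ?_, ?_⟩
    · have := i.isLt
      rw [Nat.mul_succ]
      omega
    · rw [map_mul, h2, rncPhi, aeval_X]
      ring
    · rw [← rnc_mul_nf (fun k => Ideal.Quotient.mk I2 (rncX K n k)) n hn hrel i.val
        (by have := i.isLt; omega) d B (by omega), ← h3, map_mul, mul_comm]
      congr 2
      rw [rncX, dif_pos i.isLt]
  have step : ∀ (i : Fin (n + 1)) (k : ℕ) (p : MvPolynomial (Fin (n + 1)) K),
      (∃ d A B, A + B = n * d ∧ rncPhi K n p = X 0 ^ A * X 1 ^ B ∧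
      Ideal.Quotient.mk I2 p =
        rncNF (fun k => Ideal.Quotient.mk I2 (rncX K n k)) n d B) →
      (∃ d A B, A + B = n * d ∧ rncPhi K n (p * X i ^ k) = X 0 ^ A * X 1 ^ B ∧
      Ideal.Quotient.mk I2 (p * X i ^ k) =
        rncNF (fun k => Ideal.Quotient.mk I2 (rncX K n k)) n d B) := by
    intro i k
    induction k with
    | zero => intro p hp; simpa using hp
    | succ k ih =>
      intro p hp
      rw [pow_succ, ← mul_assoc]
      exact key _ i (ih p hp)
  induction e using Finsupp.induction with
  | zero =>
    refine ⟨0, 0, 0, by simp, ?_, ?_⟩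
    · rw [show (monomial (0 : Fin (n + 1) →₀ ℕ)) (1 : K) = 1 from rfl]
      simp
    · rw [show (monomial (0 : Fin (n + 1) →₀ ℕ)) (1 : K) = 1 from rfl]
      simp [rncNF]
  | single_add i k f _ _ hf =>
    have := step i k _ hf
    rwa [X_pow_eq_monomial, monomial_mul, one_mul, add_comm f] at this

theorem rnc_ker {K : Type} [Field K] (n : ℕ) (hn : 1 ≤ n)
    (I2 : Ideal (MvPolynomial (Fin (n + 1)) K))
    (hI2 : I2 = Ideal.span {f | ∃ i j : Fin n,
      f = X i.castSucc * X j.succ - X i.succ * X j.castSucc})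
    (p : MvPolynomial (Fin (n + 1)) K) : p ∈ I2 ↔ rncPhi K n p = 0 := by
  constructor
  · intro hp
    have : I2 ≤ RingHom.ker (rncPhi K n) := by
      rw [hI2, Ideal.span_le]
      rintro f ⟨i, j, rfl⟩
      rw [SetLike.mem_coe, RingHom.mem_ker]
      simp only [rncPhi, map_sub, map_mul, aeval_X, Fin.val_castSucc, Fin.val_succ]
      obtain ⟨u, hu⟩ := Nat.exists_eq_add_of_lt i.isLt
      obtain ⟨v, hv⟩ := Nat.exists_eq_add_of_lt j.isLt
      rw [show n - i.val = u + 1 by omega, show n - j.val = v + 1 by omega,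
        show n - (i.val + 1) = u by omega, show n - (j.val + 1) = v by omega]
      ring
    exact this hp
  · intro hp
    let σ : MvPolynomial (Fin 2) K →ₗ[K] (MvPolynomial (Fin (n + 1)) K ⧸ I2) :=
      (basisMonomials (Fin 2) K).constr K (fun m =>
        rncNF (fun k => Ideal.Quotient.mk I2 (rncX K n k)) n ((m 0 + m 1) / n) (m 1))
    have hσ : σ ∘ₗ (rncPhi K n).toLinearMap = (Ideal.Quotient.mkₐ K I2).toLinearMap := by
      apply (basisMonomials (Fin (n + 1)) K).ext
      intro e
      obtain ⟨d, A, B, h1, h2, h3⟩ := rnc_monom n hn I2 hI2 e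
      simp only [coe_basisMonomials, LinearMap.comp_apply, AlgHom.toLinearMap_apply,
        Ideal.Quotient.mkₐ_eq_mk]
      rw [h2, h3]
      have h4 := rnc_mono (K := K) (Finsupp.single 0 A + Finsupp.single 1 B)
      simp only [Finsupp.add_apply, Finsupp.single_apply] at h4
      simp only [if_true, Fin.isValue, one_ne_zero, zero_ne_one, if_false, add_zero, zero_add] at h4
      rw [← h4]
      have h5 := (basisMonomials (Fin 2) K).constr_basis K (fun m =>
        rncNF (fun k => Ideal.Quotient.mk I2 (rncX K n k)) n ((m 0 + m 1) / n) (m 1))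
        (Finsupp.single 0 A + Finsupp.single 1 B)
      rw [coe_basisMonomials] at h5
      refine h5.trans ?_
      simp [h1, Nat.mul_div_cancel_left d hn]
    have := LinearMap.congr_fun hσ p
    simp only [LinearMap.comp_apply, AlgHom.toLinearMap_apply, hp, map_zero,
      Ideal.Quotient.mkₐ_eq_mk] at this
    exact Ideal.Quotient.eq_zero_iff_mem.1 this.symm

theorem rnc_range {K : Type} [Field K] (n : ℕ) (hn : 1 ≤ n) (q : MvPolynomial (Fin 2) K) :
    (∃ p, rncPhi K n p = q) ↔ ∀ m, coeff m q ≠ 0 → n ∣ m 0 + m 1 := by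
  constructor
  · rintro ⟨p, rfl⟩
    induction p using MvPolynomial.induction_on' with
    | monomial e r =>
      intro m hm
      obtain ⟨d, A, B, h1, h2, -⟩ := rnc_monom (K := K) n hn _ rfl e
      have h4 := rnc_mono (K := K) (Finsupp.single 0 A + Finsupp.single 1 B)
      simp only [Finsupp.add_apply, Finsupp.single_apply] at h4
      simp only [if_true, Fin.isValue, one_ne_zero, zero_ne_one, if_false, add_zero, zero_add] at h4
      rw [← mul_one r, ← smul_eq_mul, ← smul_monomial, map_smul, h2, ← h4, coeff_smul,
        coeff_monomial] at hm
      split_ifs at hm with h5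
      · rw [← h5]
        simp [h1]
      · simp at hm
    | add p q hp hq =>
      intro m hm
      by_cases h : coeff m (rncPhi K n p) = 0
      · apply hq
        intro h'
        apply hm
        rw [map_add, coeff_add, h, h', add_zero]
      · exact hp m h
  · intro h
    rw [q.as_sum]
    choose! g hg using fun (m : Fin 2 →₀ ℕ) (hm : coeff m q ≠ 0) =>
      (by obtain ⟨d, hd⟩ := h m hm
          exact rnc_phi_nf (K := K) n d (m 0) (m 1) hd :
        ∃ p, rncPhi K n p = X 0 ^ m 0 * X 1 ^ m 1)
    refine ⟨∑ m ∈ q.support, coeff m q • g m, ?_⟩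
    rw [map_sum]
    refine Finset.sum_congr rfl fun m hm => ?_
    rw [map_smul, hg m (mem_support_iff.1 hm), ← rnc_mono, smul_monomial, smul_eq_mul, mul_one]

theorem rnc_ndvd {K : Type} [Field K] (a b : ℕ) (ha : 1 ≤ a) (hb : 1 ≤ b) :
    ¬ (X 0 : MvPolynomial (Fin 2) K) ∣ X 0 ^ a + X 1 ^ b ∧
    ¬ (X 1 : MvPolynomial (Fin 2) K) ∣ X 0 ^ a + X 1 ^ b := by
  constructor
  · rintro ⟨r, hr⟩
    have := congrArg (eval (![0, 1] : Fin 2 → K)) hr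
    simp [zero_pow (by omega : a ≠ 0)] at this
  · rintro ⟨r, hr⟩
    have := congrArg (eval (![1, 0] : Fin 2 → K)) hr
    simp [zero_pow (by omega : b ≠ 0)] at this

theorem rnc_dvd {K : Type} [Field K] (a b c e : ℕ) (ha : 1 ≤ a) (hb : 1 ≤ b)
    (q p : MvPolynomial (Fin 2) K)
    (h : (X 0 ^ c * X 1 ^ e) * p = (X 0 ^ a + X 1 ^ b) * q) :
    ∃ r, q = (X 0 ^ c * X 1 ^ e) * r := by
  obtain ⟨h0, h1⟩ := rnc_ndvd (K := K) a b ha hb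
  have p0 : Prime (X 0 : MvPolynomial (Fin 2) K) := X_prime
  have p1 : Prime (X 1 : MvPolynomial (Fin 2) K) := X_prime
  have d0 : (X 0 : MvPolynomial (Fin 2) K) ^ c ∣ q :=
    p0.pow_dvd_of_dvd_mul_left c h0 ⟨X 1 ^ e * p, by rw [← h]; ring⟩
  obtain ⟨q1, rfl⟩ := d0
  have d1 : (X 1 : MvPolynomial (Fin 2) K) ^ e ∣ X 0 ^ c * q1 :=
    p1.pow_dvd_of_dvd_mul_left e h1 ⟨X 0 ^ c * p, by rw [← h]; ring⟩
  have h2 : ¬ (X 1 : MvPolynomial (Fin 2) K) ∣ X 0 ^ c := by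
    rintro ⟨r, hr⟩
    have := congrArg (eval (![1, 0] : Fin 2 → K)) hr
    simp at this
  obtain ⟨r, rfl⟩ := p1.pow_dvd_of_dvd_mul_left e h2 d1
  exact ⟨r, by ring⟩

theorem rnc_inter {S : Type} [CommRing S] (I : Ideal S) (f g : S)
    (h1 : ∀ p, f * p ∈ I → p ∈ I)
    (h2 : ∀ p, g * p ∈ I + Ideal.span {f} → p ∈ I + Ideal.span {f}) :
    I ⊓ Ideal.span {f, g} = I * Ideal.span {f, g} := by
  apply le_antisymm _ Ideal.mul_le_inf
  rintro z ⟨hz, hz'⟩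
  obtain ⟨u, v, rfl⟩ := Ideal.mem_span_pair.1 hz'
  have hv : v ∈ I + Ideal.span {f} := by
    apply h2
    rw [show g * v = (u * f + v * g) + f * (-u) by ring]
    exact add_mem (Ideal.mem_sup_left hz)
      (Ideal.mem_sup_right (Ideal.mul_mem_right _ _ (Ideal.mem_span_singleton_self f)))
  obtain ⟨i, hi, w, hw, rfl⟩ := Submodule.mem_sup.1 hv
  obtain ⟨r, rfl⟩ := Ideal.mem_span_singleton'.1 hw
  have hu : u + g * r ∈ I := by
    apply h1
    rw [show f * (u + g * r) = (u * f + (i + r * f) * g) - i * g by ring]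
    exact sub_mem hz (Ideal.mul_mem_right _ _ hi)
  rw [show u * f + (i + r * f) * g = (u + g * r) * f + i * g by ring]
  exact add_mem (Ideal.mul_mem_mul hu (Ideal.subset_span (by simp)))
    (Ideal.mul_mem_mul hi (Ideal.subset_span (by simp)))

/-- For `a, b, c ≥ 1`, the images of `x₁^a + x_{n+1}^b` and `xₙ^c` form a regular
sequence on `S/I₂(N)` (each is a non-zerodivisor modulo the ideal generated by `I₂(N)`
and the previous elements), and consequently
`I₂(N) ∩ ⟨x₁^a + x_{n+1}^b, xₙ^c⟩ = I₂(N)·⟨x₁^a + x_{n+1}^b, xₙ^c⟩`. -/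
theorem rnc_transversal_regular_pair {K : Type} [Field K] (n : ℕ) (hn : 1 ≤ n)
    (a b c : ℕ) (ha : 1 ≤ a) (hb : 1 ≤ b) (hc : 1 ≤ c)
    (I2 : Ideal (MvPolynomial (Fin (n + 1)) K))
    (hI2 : I2 = Ideal.span {f | ∃ i j : Fin n,
      f = X i.castSucc * X j.succ - X i.succ * X j.castSucc}) :
    (∀ p : MvPolynomial (Fin (n + 1)) K,
        (X 0 ^ a + X (Fin.last n) ^ b) * p ∈ I2 → p ∈ I2) ∧
      (∀ p : MvPolynomial (Fin (n + 1)) K,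
        (X (⟨n - 1, by omega⟩ : Fin (n + 1))) ^ c * p ∈
            I2 + Ideal.span {X 0 ^ a + X (Fin.last n) ^ b} →
          p ∈ I2 + Ideal.span {X 0 ^ a + X (Fin.last n) ^ b}) ∧
      I2 ⊓ Ideal.span {X 0 ^ a + X (Fin.last n) ^ b,
          X (⟨n - 1, by omega⟩ : Fin (n + 1)) ^ c} =
        I2 * Ideal.span {X 0 ^ a + X (Fin.last n) ^ b,
          X (⟨n - 1, by omega⟩ : Fin (n + 1)) ^ c} := by
  have hker := rnc_ker n hn I2 hI2
  have hf : rncPhi K n (X 0 ^ a + X (Fin.last n) ^ b) = X 0 ^ (n * a) + X 1 ^ (n * b) := by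
    simp [rncPhi, pow_mul]
  have hg : rncPhi K n (X (⟨n - 1, by omega⟩ : Fin (n + 1)) ^ c) =
      X 0 ^ c * X 1 ^ ((n - 1) * c) := by
    simp only [rncPhi, map_pow, aeval_X]
    rw [show n - (n - 1) = 1 by omega, pow_one, mul_pow, pow_mul]
  have hna : 1 ≤ n * a := Nat.mul_pos hn ha
  have hnb : 1 ≤ n * b := Nat.mul_pos hn hb
  have hf0 : (X 0 ^ (n * a) + X 1 ^ (n * b) : MvPolynomial (Fin 2) K) ≠ 0 := by
    intro h
    apply (rnc_ndvd (K := K) (n * a) (n * b) hna hnb).1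
    rw [h]
    exact dvd_zero _
  have H1 : ∀ p : MvPolynomial (Fin (n + 1)) K,
        (X 0 ^ a + X (Fin.last n) ^ b) * p ∈ I2 → p ∈ I2 := by
    intro p hp
    rw [hker, map_mul, hf] at hp
    rw [hker]
    exact (mul_eq_zero.1 hp).resolve_left hf0
  have H2 : ∀ p : MvPolynomial (Fin (n + 1)) K,
        (X (⟨n - 1, by omega⟩ : Fin (n + 1))) ^ c * p ∈
            I2 + Ideal.span {X 0 ^ a + X (Fin.last n) ^ b} →
          p ∈ I2 + Ideal.span {X 0 ^ a + X (Fin.last n) ^ b} := by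
    intro p hp
    obtain ⟨i, hi, w, hw, hs⟩ := Submodule.mem_sup.1 hp
    obtain ⟨q, rfl⟩ := Ideal.mem_span_singleton'.1 hw
    have e := congrArg (rncPhi K n) hs
    rw [map_add, (hker i).1 hi, zero_add, map_mul, map_mul, hf, hg, mul_comm] at e
    obtain ⟨r, hr⟩ := rnc_dvd (n * a) (n * b) c ((n - 1) * c) hna hnb _ _ e.symm
    have hrr : ∃ p', rncPhi K n p' = r := by
      rw [rnc_range n hn]
      intro m hm
      have h1 := (rnc_range n hn _).1 ⟨q, rfl⟩
        ((Finsupp.single 0 c + Finsupp.single 1 ((n - 1) * c)) + m)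
      have h4 := rnc_mono (K := K) (Finsupp.single 0 c + Finsupp.single 1 ((n - 1) * c))
      simp only [Finsupp.add_apply, Finsupp.single_apply] at h4
      simp only [if_true, Fin.isValue, one_ne_zero, zero_ne_one, if_false, add_zero,
        zero_add] at h4
      rw [hr, ← h4, coeff_monomial_mul, one_mul] at h1
      have h5 := h1 hm
      simp only [Finsupp.add_apply, Finsupp.single_apply] at h5
      simp only [if_true, Fin.isValue, one_ne_zero, zero_ne_one, if_false, add_zero,
        zero_add] at h5
      have h6 : c + m 0 + ((n - 1) * c + m 1) = n * c + (m 0 + m 1) := by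
        obtain ⟨k, rfl⟩ := Nat.exists_eq_add_of_le hn
        simp only [Nat.add_sub_cancel_left]
        ring
      rw [h6] at h5
      exact (Nat.dvd_add_right (Dvd.intro _ rfl)).1 h5
    obtain ⟨p', hp'⟩ := hrr
    have hm0 : (X 0 ^ c * X 1 ^ ((n - 1) * c) : MvPolynomial (Fin 2) K) ≠ 0 :=
      mul_ne_zero (pow_ne_zero _ (X_ne_zero _)) (pow_ne_zero _ (X_ne_zero _))
    have hfin : p - (X 0 ^ a + X (Fin.last n) ^ b) * p' ∈ I2 := by
      rw [hker, map_sub, map_mul, hf, hp', sub_eq_zero]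
      apply mul_left_cancel₀ hm0
      rw [← e, hr]
      ring
    rw [← sub_add_cancel p ((X 0 ^ a + X (Fin.last n) ^ b) * p')]
    exact add_mem (Ideal.mem_sup_left hfin)
      (Ideal.mem_sup_right (Ideal.mul_mem_right _ _ (Ideal.mem_span_singleton_self _)))
  exact ⟨H1, H2, rnc_inter I2 _ _ H1 H2⟩
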